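/- arXiv:1203.0468 — 4 statements merged into one kernel-verified Lean document; each statement's English description precedes it below -/
import Mathlib

section
/- Let ℓ ≥ 1 and let α_1, …, α_ℓ be positive integers, and set d = (∑_{i=1}^ℓ α_i) − ℓ + 1, so d ≥ 1. Then, as an identity of integers, ∑_{a=0}^{d−1} (−1)^a · binom(d−1,a) · ∏_{i=1}^{ℓ} ( (a−d+1)^{α_i+1} − (a−d)^{α_i+1} + a^{α_i+1} − (a+1)^{α_i+1} ) = (−1)^{d+ℓ−1} · d^{ℓ−1} · d! · ∏_{i=1}^{ℓ} α_i (α_i + 1). -/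
open Polynomial in
/-- The alternating binomial sum of a polynomial of degree at most `n` extracts its coefficient
of degree `n`. -/
lemma Polynomial.sum_neg_one_pow_mul_choose_mul_eval {P : ℤ[X]} {n : ℕ} (hP : P.natDegree ≤ n) :
    ∑ a ∈ Finset.range (n + 1), (-1 : ℤ) ^ a * (n.choose a : ℤ) * P.eval (a : ℤ)
      = (-1) ^ n * (n.factorial : ℤ) * P.coeff n := by
  have key : (fwdDiff (1 : ℤ))^[n] P.eval 0 = P.coeff n * (n.factorial : ℤ) := by
    rcases hP.lt_or_eq with h | rfl
    · rw [fwdDiff_iter_eq_zero_of_degree_lt h, coeff_eq_zero_of_natDegree_lt h]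
      simp
    · rw [fwdDiff_iter_degree_eq_factorial]
      simp
  rw [fwdDiff_iter_eq_sum_shift] at key
  rw [mul_assoc, mul_comm (n.factorial : ℤ), ← key, Finset.mul_sum]
  refine Finset.sum_congr rfl fun a ha => ?_
  obtain ⟨m, rfl⟩ := Nat.exists_eq_add_of_le (Nat.lt_succ_iff.mp (Finset.mem_range.mp ha))
  have hm : (-1 : ℤ) ^ m * (-1) ^ m = 1 := by rw [← mul_pow]; simp
  simp only [Nat.add_sub_cancel_left, smul_eq_mul, nsmul_eq_mul, mul_one, zero_add, pow_add]
  linear_combination (-((-1 : ℤ) ^ a * ((a + m).choose a : ℤ) * P.eval (a : ℤ))) * hm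

open Polynomial in
/-- If `natDegree (f i) ≤ e i`, the coefficient of degree `∑ e i` of `∏ f i` is the product of the
coefficients of degree `e i` of the `f i`. -/
lemma Polynomial.coeff_prod_sum_of_natDegree_le {R ι : Type*} [CommSemiring R] (s : Finset ι)
    (f : ι → R[X]) (e : ι → ℕ) (h : ∀ i ∈ s, (f i).natDegree ≤ e i) :
    (∏ i ∈ s, f i).coeff (∑ i ∈ s, e i) = ∏ i ∈ s, (f i).coeff (e i) := by
  classical
  induction s using Finset.induction_on with
  | empty => simp
  | insert i s hi ih =>
    have hs : ∀ j ∈ s, (f j).natDegree ≤ e j := fun j hj => h j (Finset.mem_insert_of_mem hj)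
    rw [Finset.prod_insert hi, Finset.sum_insert hi, Finset.prod_insert hi, ← ih hs]
    exact coeff_mul_add_eq_of_natDegree_le (h i (Finset.mem_insert_self i s))
      ((natDegree_prod_le s f).trans (Finset.sum_le_sum hs))

open Polynomial in
/-- The polynomial `(x - d + 1)ⁿ - (x - d)ⁿ + xⁿ - (x + 1)ⁿ` in the variable `x`. -/
noncomputable def capFactor (d : ℤ) (n : ℕ) : ℤ[X] :=
  (X + C (1 - d)) ^ n - (X + C (-d)) ^ n + (X + C 0) ^ n - (X + C 1) ^ n

lemma capFactor_eval (d x : ℤ) (n : ℕ) :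
    (capFactor d n).eval x = (x - d + 1) ^ n - (x - d) ^ n + x ^ n - (x + 1) ^ n := by
  simp only [capFactor, Polynomial.eval_sub, Polynomial.eval_add, Polynomial.eval_pow,
    Polynomial.eval_X, Polynomial.eval_C]
  ring

lemma capFactor_coeff (d : ℤ) (n k : ℕ) :
    (capFactor d n).coeff k
      = ((1 - d) ^ (n - k) - (-d) ^ (n - k) + 0 ^ (n - k) - 1 ^ (n - k)) * (n.choose k : ℤ) := by
  simp only [capFactor, Polynomial.coeff_sub, Polynomial.coeff_add, Polynomial.coeff_X_add_C_pow]
  ring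

lemma capFactor_natDegree_le (d : ℤ) (m : ℕ) : (capFactor d (m + 2)).natDegree ≤ m := by
  rw [Polynomial.natDegree_le_iff_coeff_eq_zero]
  intro k hk
  rw [capFactor_coeff]
  rcases (show k = m + 1 ∨ m + 2 ≤ k by omega) with rfl | h
  · rw [show m + 2 - (m + 1) = 1 by omega]
    ring
  · simp [Nat.sub_eq_zero_of_le h]

lemma capFactor_coeff_top (d : ℤ) (m : ℕ) :
    (capFactor d (m + 2)).coeff m = -d * (((m : ℤ) + 1) * ((m : ℤ) + 2)) := by
  have h : ((m + 2).choose m : ℤ) * 2 = ((m : ℤ) + 1) * ((m : ℤ) + 2) := by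
    rw [Nat.choose_symm_add]
    have h2 := Nat.add_one_mul_choose_eq (m + 1) 1
    rw [Nat.choose_one_right] at h2
    zify at h2
    linear_combination -h2
  rw [capFactor_coeff, Nat.add_sub_cancel_left]
  linear_combination (-d) * h

/-- Let `ℓ ≥ 1` and `α_1, …, α_ℓ` be positive integers, and set
`d = (∑ α_i) − ℓ + 1` (so `d ≥ 1`).  Then
`∑_{a=0}^{d−1} (−1)^a binom(d−1,a) ∏_i ((a−d+1)^{α_i+1} − (a−d)^{α_i+1} + a^{α_i+1} − (a+1)^{α_i+1})
  = (−1)^{d+ℓ−1} d^{ℓ−1} d! ∏_i α_i (α_i+1)`. -/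
theorem stable_pairs_cap_character_sum (ℓ : ℕ) (hℓ : 1 ≤ ℓ) (α : Fin ℓ → ℕ)
    (hα : ∀ i, 1 ≤ α i) (d : ℕ) (hd : d + ℓ = (∑ i, α i) + 1) :
    (∑ a ∈ Finset.range d, (-1 : ℤ) ^ a * ((d - 1).choose a : ℤ) *
        ∏ i, (((a : ℤ) - d + 1) ^ (α i + 1) - ((a : ℤ) - d) ^ (α i + 1)
          + (a : ℤ) ^ (α i + 1) - ((a : ℤ) + 1) ^ (α i + 1)))
      = (-1 : ℤ) ^ (d + ℓ - 1) * (d : ℤ) ^ (ℓ - 1) * (Nat.factorial d : ℤ) *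
          ∏ i, (α i : ℤ) * ((α i : ℤ) + 1) := by
  obtain ⟨β, rfl⟩ : ∃ β : Fin ℓ → ℕ, α = fun i => β i + 1 :=
    ⟨fun i => α i - 1, funext fun i => (Nat.sub_add_cancel (hα i)).symm⟩
  obtain ⟨k, rfl⟩ := Nat.exists_eq_add_of_le' hℓ
  have hd' : d = (∑ i, β i) + 1 := by
    simp only [Finset.sum_add_distrib, Finset.sum_const, Finset.card_univ, Fintype.card_fin,
      smul_eq_mul, mul_one] at hd
    omega
  obtain ⟨n, rfl⟩ : ∃ n, d = n + 1 := ⟨_, hd'⟩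
  have hn : n = ∑ i, β i := by omega
  set D : ℤ := ((n + 1 : ℕ) : ℤ) with hD
  have hdeg : (∏ i, capFactor D (β i + 2)).natDegree ≤ n := by
    rw [hn]
    exact (Polynomial.natDegree_prod_le _ _).trans
      (Finset.sum_le_sum fun i _ => capFactor_natDegree_le _ _)
  have hcoeff : (∏ i, capFactor D (β i + 2)).coeff n
      = (-D) ^ (k + 1) * ∏ i, (((β i : ℤ) + 1) * ((β i : ℤ) + 2)) := by
    rw [hn, Polynomial.coeff_prod_sum_of_natDegree_le _ _ _
      fun i _ => capFactor_natDegree_le _ _]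
    simp only [capFactor_coeff_top, Finset.prod_mul_distrib, Finset.prod_const, Finset.card_univ,
      Fintype.card_fin]
  have key := Polynomial.sum_neg_one_pow_mul_choose_mul_eval hdeg
  simp only [Polynomial.eval_prod, capFactor_eval, hcoeff] at key
  simp only [Nat.add_sub_cancel, add_assoc, Nat.reduceAdd] at key ⊢
  rw [key, show n + (1 + (k + 1)) - 1 = n + (k + 1) by omega, Nat.factorial_succ, neg_pow D,
    Nat.cast_mul, ← hD]
  push_cast
  simp only [add_assoc, Int.reduceAdd]
  ring
end

section
/- For every finite set T, the sum ∑_P ∏_{S∈P} (−1)^{|S|−1} (|S|−1)! equals 1 if |T| ≤ 1 and equals 0 if |T| ≥ 2, where the sum runs over all set partitions P of T and the product runs over the parts S of P. -/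
namespace Finpartition

variable {α : Type*} [DecidableEq α] {T : Finset α} {a : α}

theorem eq_of_mem_insert_empty_parts (P : Finpartition T) {B C : Finset α} {x : α}
    (hB : B ∈ insert ∅ P.parts) (hC : C ∈ P.parts) (hxB : x ∈ B) (hxC : x ∈ C) : B = C := by
  rcases Finset.mem_insert.1 hB with rfl | hB
  · simp at hxB
  · exact P.eq_of_mem_parts hB hC hxB hxC

theorem notMem_of_mem_insert_empty_parts (P : Finpartition T) (ha : a ∉ T) {B : Finset α}
    (hB : B ∈ insert ∅ P.parts) : a ∉ B := by
  rcases Finset.mem_insert.1 hB with rfl | hB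
  · simp
  · exact fun h => ha (P.subset hB h)

/-- Add a new element `a` to the block `B` of `P`, or as a singleton block if `B = ∅`. -/
def insertElement (P : Finpartition T) (ha : a ∉ T) (B : Finset α)
    (hB : B ∈ insert ∅ P.parts) : Finpartition (insert a T) :=
  ofExistsUnique (insert (insert a B) (P.parts.erase B))
    (by
      have hBT : B ⊆ T := by
        rcases Finset.mem_insert.1 hB with rfl | hB
        · simp
        · exact P.subset hB
      intro p hp
      rcases Finset.mem_insert.1 hp with rfl | hp
      · exact Finset.insert_subset_insert a hBT
      · exact (P.subset (Finset.mem_of_mem_erase hp)).trans (Finset.subset_insert a T))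
    (by
      intro x hx
      by_cases hxB : x ∈ insert a B
      · refine ⟨insert a B, ⟨by simp, hxB⟩, ?_⟩
        rintro C ⟨hC, hxC⟩
        rcases Finset.mem_insert.1 hC with rfl | hC
        · rfl
        obtain ⟨hCB, hC⟩ := Finset.mem_erase.1 hC
        rcases Finset.mem_insert.1 hxB with hxa | hxB
        · exact absurd (P.subset hC (hxa ▸ hxC)) ha
        · exact absurd (P.eq_of_mem_insert_empty_parts hB hC hxB hxC).symm hCB
      · have hxT : x ∈ T := by grind
        obtain ⟨C, hC, hxC⟩ := P.exists_mem hxT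
        refine ⟨C, ⟨by grind, hxC⟩, ?_⟩
        rintro D ⟨hD, hxD⟩
        rcases Finset.mem_insert.1 hD with rfl | hD
        · exact absurd hxD hxB
        · exact P.eq_of_mem_parts (Finset.mem_of_mem_erase hD) hC hxD hxC)
    (by
      intro h
      rcases Finset.mem_insert.1 h with h | h
      · exact Finset.insert_ne_empty a B h.symm
      · exact P.empty_notMem_parts (Finset.mem_of_mem_erase h))

theorem insertElement_parts (P : Finpartition T) (ha : a ∉ T) (B : Finset α)
    (hB : B ∈ insert ∅ P.parts) :
    (P.insertElement ha B hB).parts = insert (insert a B) (P.parts.erase B) := rfl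

theorem insertElement_injective (ha : a ∉ T) {P Q : Finpartition T} {B C : Finset α}
    (hB : B ∈ insert ∅ P.parts) (hC : C ∈ insert ∅ Q.parts)
    (h : P.insertElement ha B hB = Q.insertElement ha C hC) : P = Q ∧ B = C := by
  have h := congrArg parts h
  simp only [insertElement_parts] at h
  have hP : ∀ p ∈ P.parts, a ∉ p := fun p hp hap => ha (P.subset hp hap)
  have hQ : ∀ p ∈ Q.parts, a ∉ p := fun p hp hap => ha (Q.subset hp hap)
  have haB := P.notMem_of_mem_insert_empty_parts ha hB
  have haC := Q.notMem_of_mem_insert_empty_parts ha hC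
  have hBC : B = C := by
    have h1 : insert a B ∈ insert (insert a C) (Q.parts.erase C) := h ▸ by simp
    rcases Finset.mem_insert.1 h1 with h1 | h1
    · rw [← Finset.erase_insert haB, h1, Finset.erase_insert haC]
    · exact absurd (Finset.mem_insert_self a B) (hQ _ (Finset.mem_of_mem_erase h1))
  subst hBC
  refine ⟨?_, rfl⟩
  have hP0 := P.empty_notMem_parts
  have hQ0 := Q.empty_notMem_parts
  have h2 : P.parts.erase B = Q.parts.erase B := by
    have h3 := congrArg (fun s => s.erase (insert a B)) h
    simpa [Finset.erase_insert, show insert a B ∉ P.parts from fun h => hP _ h (by simp),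
      show insert a B ∉ Q.parts from fun h => hQ _ h (by simp)] using h3
  ext1
  by_cases hB0 : B = ∅
  · subst hB0
    rwa [Finset.erase_eq_of_notMem hP0, Finset.erase_eq_of_notMem hQ0] at h2
  · rw [← Finset.insert_erase ((Finset.mem_insert.1 hB).resolve_left hB0), h2,
      Finset.insert_erase ((Finset.mem_insert.1 hC).resolve_left hB0)]

theorem exists_insertElement_eq (ha : a ∉ T) (Q : Finpartition (insert a T)) :
    ∃ (P : Finpartition T) (B : Finset α) (hB : B ∈ insert ∅ P.parts),
      P.insertElement ha B hB = Q := by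
  have hT : insert a T \ {a} = T := by
    rw [Finset.sdiff_singleton_eq_erase, Finset.erase_insert ha]
  obtain ⟨A, hA, haA⟩ := Q.exists_mem (Finset.mem_insert_self a T)
  have hQ : ∀ C ∈ Q.parts, C ≠ A → a ∉ C := fun C hC hCA haC =>
    hCA (Q.eq_of_mem_parts hC hA haC haA)
  have hmem : ∀ C, C ∈ ((Q.avoid {a}).copy hT).parts ↔
      ∃ d ∈ Q.parts, ¬ d ⊆ {a} ∧ d \ {a} = C := fun C => Q.mem_avoid
  refine ⟨(Q.avoid {a}).copy hT, A.erase a, ?_, ?_⟩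
  · rw [Finset.mem_insert, hmem]
    by_cases h : A ⊆ {a}
    · left; grind
    · exact Or.inr ⟨A, hA, h, by rw [Finset.sdiff_singleton_eq_erase]⟩
  · ext1
    rw [insertElement_parts, Finset.insert_erase haA]
    ext C
    rw [Finset.mem_insert, Finset.mem_erase, hmem]
    constructor
    · rintro (rfl | ⟨hCA, d, hd, -, rfl⟩)
      · exact hA
      · by_cases hdA : d = A
        · subst hdA
          simp [Finset.sdiff_singleton_eq_erase] at hCA
        · rwa [Finset.sdiff_singleton_eq_erase, Finset.erase_eq_of_notMem (hQ d hd hdA)]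
    · intro hC
      by_cases hCA : C = A
      · exact Or.inl hCA
      · have haC := hQ C hC hCA
        obtain ⟨x, hx⟩ := Q.nonempty_of_mem_parts hC
        refine Or.inr ⟨?_, C, hC, ?_, ?_⟩
        · rintro rfl
          exact hCA (Q.eq_of_mem_parts hC hA hx (Finset.mem_of_mem_erase hx))
        · intro h
          exact haC (Finset.mem_singleton.1 (h hx) ▸ hx)
        · rw [Finset.sdiff_singleton_eq_erase, Finset.erase_eq_of_notMem haC]

theorem sum_insert {M : Type*} [AddCommMonoid M] (ha : a ∉ T) (f : Finset (Finset α) → M) :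
    ∑ Q : Finpartition (insert a T), f Q.parts =
      ∑ P : Finpartition T, ∑ B ∈ insert ∅ P.parts,
        f (insert (insert a B) (P.parts.erase B)) := by
  rw [Finset.sum_sigma']
  symm
  refine Finset.sum_bij
    (fun x hx => x.1.insertElement ha x.2 (Finset.mem_sigma.1 hx).2) ?_ ?_ ?_ ?_
  · intro x hx
    exact Finset.mem_univ _
  · rintro ⟨P, B⟩ hx ⟨Q, C⟩ hy h
    obtain ⟨rfl, rfl⟩ := insertElement_injective ha _ _ h
    rfl
  · intro Q _
    obtain ⟨P, B, hB, h⟩ := exists_insertElement_eq ha Q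
    exact ⟨⟨P, B⟩, Finset.mem_sigma.2 ⟨Finset.mem_univ _, hB⟩, h⟩
  · intro x hx
    rfl

theorem sum_prod_neg_one_pow_mul_factorial_insert (ha : a ∉ T) :
    ∑ P : Finpartition (insert a T),
        ∏ S ∈ P.parts, (-1 : ℤ) ^ (S.card - 1) * (Nat.factorial (S.card - 1) : ℤ) =
      (1 - T.card) * ∑ P : Finpartition T,
        ∏ S ∈ P.parts, (-1 : ℤ) ^ (S.card - 1) * (Nat.factorial (S.card - 1) : ℤ) := by
  rw [sum_insert ha (fun s => ∏ S ∈ s,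
    (-1 : ℤ) ^ (S.card - 1) * (Nat.factorial (S.card - 1) : ℤ)), Finset.mul_sum]
  refine Finset.sum_congr rfl fun P _ => ?_
  have hP : ∀ p ∈ P.parts, a ∉ p := fun p hp hap => ha (P.subset hp hap)
  have hnew : ∀ B, insert a B ∉ P.parts.erase B := fun B h =>
    hP _ (Finset.mem_of_mem_erase h) (Finset.mem_insert_self a B)
  rw [Finset.sum_insert P.empty_notMem_parts, Finset.prod_insert (hnew ∅),
    Finset.erase_eq_of_notMem P.empty_notMem_parts, ← P.sum_card_parts, Nat.cast_sum,
    sub_mul, Finset.sum_mul, sub_eq_add_neg, ← Finset.sum_neg_distrib]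
  refine congrArg₂ _ (by simp) ?_
  refine Finset.sum_congr rfl fun B hB => ?_
  rw [Finset.prod_insert (hnew B), ← Finset.mul_prod_erase _ _ hB,
    Finset.card_insert_of_notMem (hP B hB)]
  obtain ⟨n, hn⟩ := Nat.exists_eq_succ_of_ne_zero
    (Finset.card_pos.2 (P.nonempty_of_mem_parts hB)).ne'
  simp only [hn, Nat.succ_eq_add_one, Nat.add_sub_cancel, Nat.factorial_succ, pow_succ]
  push_cast
  ring

end Finpartition

/-- For every finite set `T`, the sum over all set partitions `P` of `T` of
`∏_{S ∈ P} (−1)^{|S|−1} (|S|−1)!` equals `1` if `|T| ≤ 1` and `0` if `|T| ≥ 2`. -/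
theorem fundamental_set_partition_identity {α : Type*} [DecidableEq α] (T : Finset α) :
    (∑ P : Finpartition T,
        ∏ S ∈ P.parts, (-1 : ℤ) ^ (S.card - 1) * (Nat.factorial (S.card - 1) : ℤ))
      = if T.card ≤ 1 then 1 else 0 := by
  induction T using Finset.induction_on with
  | empty =>
    have hempty : ∀ P : Finpartition (∅ : Finset α), P.parts = ∅ := fun P =>
      P.parts_eq_empty_iff.2 rfl
    have hcard : Fintype.card (Finpartition (∅ : Finset α)) = 1 :=
      Fintype.card_eq_one_iff.2 ⟨Finpartition.empty _, fun P =>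
        Finpartition.ext ((hempty P).trans (hempty _).symm)⟩
    simp [hempty, hcard]
  | insert a T ha ih =>
    rw [Finpartition.sum_prod_neg_one_pow_mul_factorial_insert ha, ih,
      Finset.card_insert_of_notMem ha]
    rcases Nat.lt_trichotomy T.card 1 with h | h | h
    · simp [Nat.lt_one_iff.1 h]
    · simp [h]
    · rw [if_neg (by omega), if_neg (by omega), mul_zero]
end

section
/- Let R be a commutative ring, let ℓ ≥ 1, and let g_b and g_s be functions assigning to every nonempty subset of {1,…,ℓ} an element of R, extended by the convention g_b(∅) = g_s(∅) = 1. For each nonempty subset S define g̃_b(S) = ∑_P (−1)^{|P|−1} (|P|−1)! ∏_{U∈P} g_b(U), the sum over all set partitions P of S, and similarly g̃_s(S). Then ∑_Q g̃_b(Q₁) · ∏_{S∈Q, S≠Q₁} ( g̃_b(S) + (−1)^{|S|} g̃_s(S) ) = ∑_{B ⊆ {2,…,ℓ}} (−1)^{|B|} · g_b({1,…,ℓ} ∖ B) · g_s(B), where the left-hand sum runs over all set partitions Q of {1,…,ℓ} and Q₁ denotes the part of Q containing 1. -/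
open Finset

/-- The "tilde" transform of a function `g` on subsets: for a subset `S`,
`g̃(S) = ∑_P (−1)^{|P|−1} (|P|−1)! ∏_{U ∈ P} g(U)`, the sum running over all set
partitions `P` of `S` (with `|P|` the number of parts). -/
noncomputable def tildeTransform {α : Type*} [DecidableEq α] {R : Type*} [CommRing R]
    (g : Finset α → R) (S : Finset α) : R :=
  ∑ P : Finpartition S,
    (-1 : R) ^ (P.parts.card - 1) * (Nat.factorial (P.parts.card - 1) : R) *
      ∏ U ∈ P.parts, g U

/-- The set partitions of `S`, as finsets of finsets. -/
def partitionParts {α : Type*} [DecidableEq α] (S : Finset α) : Finset (Finset (Finset α)) :=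
  (univ : Finset (Finpartition S)).image Finpartition.parts

/-- The subset convolution of two functions on finsets. -/
def subsetConv {α : Type*} [DecidableEq α] {R : Type*} [CommRing R]
    (f g : Finset α → R) (S : Finset α) : R :=
  ∑ T ∈ S.powerset, f T * g (S \ T)

/-- The sum over set partitions of the product of the values of `f` on the parts. -/
def partitionSum {α : Type*} [DecidableEq α] {R : Type*} [CommRing R]
    (f : Finset α → R) (S : Finset α) : R :=
  ∑ P : Finpartition S, ∏ U ∈ P.parts, f U

/-- The restriction of `f` to the finsets containing `a`, extended by zero. -/
def pointedPart {α : Type*} [DecidableEq α] {R : Type*} [CommRing R]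
    (a : α) (f : Finset α → R) (S : Finset α) : R :=
  if a ∈ S then f S else 0

/-- The convolution inverse of `g` (when `g ∅ = 1`), as a signed sum over set partitions. -/
def convInverse {α : Type*} [DecidableEq α] {R : Type*} [CommRing R]
    (g : Finset α → R) (S : Finset α) : R :=
  ∑ P : Finpartition S,
    (-1 : R) ^ P.parts.card * (Nat.factorial P.parts.card : R) * ∏ U ∈ P.parts, g U

section

variable {α : Type*} [DecidableEq α] {R : Type*} [CommRing R]

theorem mem_partitionParts {S : Finset α} {A : Finset (Finset α)} :
    A ∈ partitionParts S ↔
      ∅ ∉ A ∧ (A : Set (Finset α)).PairwiseDisjoint id ∧ A.biUnion id = S := by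
  simp only [partitionParts, mem_image, mem_univ, true_and]
  constructor
  · rintro ⟨P, rfl⟩
    exact ⟨P.empty_notMem_parts, P.disjoint, P.biUnion_parts⟩
  · rintro ⟨h0, hd, hS⟩
    exact ⟨⟨A, supIndep_iff_pairwiseDisjoint.2 hd, by rw [sup_eq_biUnion, hS], h0⟩, rfl⟩

theorem sum_partitionParts (S : Finset α) (F : Finset (Finset α) → R) :
    ∑ A ∈ partitionParts S, F A = ∑ P : Finpartition S, F P.parts :=
  sum_image fun _ _ _ _ h => Finpartition.ext h

theorem erase_mem_partitionParts {S U : Finset α} {A : Finset (Finset α)}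
    (hA : A ∈ partitionParts S) (hU : U ∈ A) : A.erase U ∈ partitionParts (S \ U) := by
  rw [mem_partitionParts] at hA ⊢
  obtain ⟨h0, hd, rfl⟩ := hA
  refine ⟨fun h => h0 (mem_of_mem_erase h), hd.subset (by simp), ?_⟩
  ext x
  simp only [mem_biUnion, mem_erase, mem_sdiff, id]
  constructor
  · rintro ⟨V, ⟨hVU, hV⟩, hx⟩
    exact ⟨⟨V, hV, hx⟩, fun hxU => disjoint_left.1 (hd hV hU hVU) hx hxU⟩
  · rintro ⟨⟨V, hV, hx⟩, hxU⟩
    exact ⟨V, ⟨fun h => hxU (h ▸ hx), hV⟩, hx⟩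

theorem notMem_of_mem_partitionParts_sdiff {S U : Finset α} {A : Finset (Finset α)}
    (hU : U.Nonempty) (hA : A ∈ partitionParts (S \ U)) : U ∉ A := by
  intro h
  obtain ⟨-, -, hS⟩ := mem_partitionParts.1 hA
  obtain ⟨x, hx⟩ := hU
  have : x ∈ S \ U := hS ▸ mem_biUnion.2 ⟨U, h, hx⟩
  exact (mem_sdiff.1 this).2 hx

theorem insert_mem_partitionParts {S U : Finset α} {A : Finset (Finset α)}
    (hUS : U ⊆ S) (hU : U.Nonempty) (hA : A ∈ partitionParts (S \ U)) :
    insert U A ∈ partitionParts S := by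
  rw [mem_partitionParts] at hA ⊢
  obtain ⟨h0, hd, hS⟩ := hA
  refine ⟨?_, ?_, ?_⟩
  · rw [mem_insert, not_or]
    exact ⟨hU.ne_empty.symm, h0⟩
  · rw [coe_insert]
    refine hd.insert fun V hV _ => ?_
    have hVS : V ⊆ S \ U := hS ▸ subset_biUnion_of_mem id hV
    exact disjoint_sdiff.mono_right hVS
  · rw [biUnion_insert, hS]
    exact union_sdiff_of_subset hUS

/-- Marking one part of a set partition amounts to choosing that part and then a set partition of
its complement. -/
theorem sum_finpartition_sum_parts (S : Finset α) (F : Finset α → Finset (Finset α) → R) :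
    ∑ P : Finpartition S, ∑ U ∈ P.parts, F U (P.parts.erase U) =
      ∑ U ∈ S.powerset, if U.Nonempty then ∑ P : Finpartition (S \ U), F U P.parts else 0 := by
  rw [← sum_partitionParts S fun A => ∑ U ∈ A, F U (A.erase U), ← sum_filter]
  simp_rw [← sum_partitionParts]
  rw [sum_sigma', sum_sigma']
  refine sum_nbij' (fun x => ⟨x.2, x.1.erase x.2⟩) (fun x => ⟨insert x.1 x.2, x.1⟩) ?_ ?_ ?_ ?_ ?_
  · rintro ⟨A, U⟩ h
    simp only [mem_sigma, mem_filter, mem_powerset] at h ⊢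
    obtain ⟨hA, hU⟩ := h
    refine ⟨⟨?_, ?_⟩, erase_mem_partitionParts hA hU⟩
    · exact (mem_partitionParts.1 hA).2.2 ▸ subset_biUnion_of_mem id hU
    · exact nonempty_iff_ne_empty.2 fun h => (mem_partitionParts.1 hA).1 (h ▸ hU)
  · rintro ⟨U, A⟩ h
    simp only [mem_sigma, mem_filter, mem_powerset] at h ⊢
    exact ⟨insert_mem_partitionParts h.1.1 h.1.2 h.2, mem_insert_self _ _⟩
  · rintro ⟨A, U⟩ h
    simp only [mem_sigma] at h
    simp [insert_erase h.2]
  · rintro ⟨U, A⟩ h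
    simp only [mem_sigma, mem_filter, mem_powerset] at h
    simp [erase_insert (notMem_of_mem_partitionParts_sdiff h.1.2 h.2)]
  · rintro ⟨A, U⟩ _
    rfl

/-- A set partition of `S` is determined by the part containing `a ∈ S` and a set partition of its
complement. -/
theorem sum_finpartition_of_mem {S : Finset α} {a : α} (ha : a ∈ S)
    (F : Finset α → Finset (Finset α) → R) :
    ∑ P : Finpartition S, F (P.part a) (P.parts.erase (P.part a)) =
      ∑ U ∈ S.powerset, if a ∈ U then ∑ P : Finpartition (S \ U), F U P.parts else 0 := by
  have h := sum_finpartition_sum_parts S fun U A => if a ∈ U then F U A else 0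
  have hl (P : Finpartition S) :
      ∑ U ∈ P.parts, (if a ∈ U then F U (P.parts.erase U) else 0) =
        F (P.part a) (P.parts.erase (P.part a)) := by
    rw [sum_eq_single (P.part a)]
    · rw [if_pos (P.mem_part_self.2 ha)]
    · intro U hU hne
      exact if_neg fun haU => hne (P.part_eq_of_mem hU haU).symm
    · exact fun h => absurd (P.part_mem.2 ha) h
  simp_rw [hl] at h
  rw [h]
  refine sum_congr rfl fun U _ => ?_
  by_cases haU : a ∈ U
  · simp [haU, show U.Nonempty from ⟨a, haU⟩]
  · simp [haU]

theorem subsetConv_comm (f g : Finset α → R) : subsetConv f g = subsetConv g f := by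
  funext S
  refine sum_nbij' (S \ ·) (S \ ·) ?_ ?_ ?_ ?_ ?_
  · simp
  · simp
  · intro T hT
    exact Finset.sdiff_sdiff_eq_self (mem_powerset.1 hT)
  · intro T hT
    exact Finset.sdiff_sdiff_eq_self (mem_powerset.1 hT)
  · intro T hT
    rw [Finset.sdiff_sdiff_eq_self (mem_powerset.1 hT), mul_comm]

theorem subsetConv_assoc (f g h : Finset α → R) :
    subsetConv (subsetConv f g) h = subsetConv f (subsetConv g h) := by
  funext S
  simp only [subsetConv, sum_mul, mul_sum]
  rw [sum_sigma', sum_sigma']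
  refine sum_nbij' (fun x => ⟨x.2, x.1 \ x.2⟩) (fun x => ⟨x.1 ∪ x.2, x.1⟩) ?_ ?_ ?_ ?_ ?_
  · rintro ⟨T, U⟩ h
    simp only [mem_sigma, mem_powerset] at h ⊢
    exact ⟨h.2.trans h.1, sdiff_subset_sdiff h.1 le_rfl⟩
  · rintro ⟨T, U⟩ h
    simp only [mem_sigma, mem_powerset] at h ⊢
    exact ⟨union_subset h.1 (h.2.trans sdiff_subset), subset_union_left⟩
  · rintro ⟨T, U⟩ h
    simp only [mem_sigma, mem_powerset] at h
    simp [union_eq_right.2 h.2]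
  · rintro ⟨T, U⟩ h
    simp only [mem_sigma, mem_powerset] at h
    have : Disjoint U T := disjoint_sdiff_self_left.mono_left h.2
    simp [union_sdiff_left, sdiff_eq_self_of_disjoint this]
  · rintro ⟨T, U⟩ h
    simp only [mem_sigma, mem_powerset] at h
    have : (S \ U) \ (T \ U) = S \ T := by
      rw [sdiff_sdiff_left, sup_eq_union, union_sdiff_of_subset h.2]
    simp only [this, mul_assoc]

theorem subsetConv_add_left (f g h : Finset α → R) :
    subsetConv (f + g) h = subsetConv f h + subsetConv g h := by
  funext S
  simp [subsetConv, add_mul, sum_add_distrib]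

theorem subsetConv_empty (f g : Finset α → R) : subsetConv f g ∅ = f ∅ * g ∅ := by
  simp [subsetConv]

theorem subsetConv_single_empty (f : Finset α → R) :
    subsetConv f (Pi.single ∅ 1) = f := by
  funext S
  rw [subsetConv, sum_eq_single S]
  · simp
  · intro T hT hne
    have : S \ T ≠ ∅ := fun h =>
      hne (subset_antisymm (mem_powerset.1 hT) (sdiff_eq_empty_iff_subset.1 h))
    simp [this]
  · simp

theorem pointedPart_add (a : α) (f g : Finset α → R) :
    pointedPart a (f + g) = pointedPart a f + pointedPart a g := by
  funext S
  simp only [pointedPart, Pi.add_apply]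
  split_ifs <;> simp

/-- Marking a point is a derivation for the subset convolution. -/
theorem pointedPart_subsetConv (a : α) (f g : Finset α → R) :
    pointedPart a (subsetConv f g) =
      subsetConv (pointedPart a f) g + subsetConv f (pointedPart a g) := by
  funext S
  simp only [pointedPart, subsetConv, Pi.add_apply, ← sum_add_distrib]
  split_ifs with ha
  · refine sum_congr rfl fun T _ => ?_
    by_cases haT : a ∈ T <;> simp [ha, haT]
  · refine (sum_eq_zero fun T hT => ?_).symm
    have haT : a ∉ T := fun h => ha (mem_powerset.1 hT h)
    simp [ha, haT]

theorem sum_finpartition_empty (F : Finset (Finset α) → R) :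
    ∑ P : Finpartition (∅ : Finset α), F P.parts = F ∅ := by
  have : Unique (Finpartition (∅ : Finset α)) :=
    inferInstanceAs (Unique (Finpartition (⊥ : Finset α)))
  rw [Fintype.sum_unique, Finpartition.parts_eq_empty_iff.2 rfl]

theorem partitionSum_empty (f : Finset α → R) : partitionSum f ∅ = 1 := by
  rw [partitionSum, sum_finpartition_empty fun A => ∏ U ∈ A, f U, prod_empty]

theorem pointedPart_partitionSum (a : α) (f : Finset α → R) :
    pointedPart a (partitionSum f) = subsetConv (pointedPart a f) (partitionSum f) := by
  funext S
  simp only [pointedPart, subsetConv, partitionSum]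
  split_ifs with ha
  · have h := sum_finpartition_of_mem ha fun U A => f U * ∏ V ∈ A, f V
    simp only [ite_mul, zero_mul]
    simp only [← mul_sum (univ : Finset (Finpartition (_ \ _)))] at h
    rw [← h]
    exact sum_congr rfl fun P _ => (mul_prod_erase _ _ (P.part_mem.2 ha)).symm
  · refine (sum_eq_zero fun T hT => ?_).symm
    rw [if_neg fun h => ha (mem_powerset.1 hT h), zero_mul]

/-- `partitionSum f` is the only solution of `∂ₐ H = (∂ₐ f) * H`, `H ∅ = 1`. -/
theorem eq_partitionSum {f H : Finset α → R} (h0 : H ∅ = 1)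
    (h : ∀ a, pointedPart a H = subsetConv (pointedPart a f) H) : H = partitionSum f := by
  funext S
  induction S using Finset.strongInduction with
  | H S ih =>
    obtain rfl | ⟨a, ha⟩ := S.eq_empty_or_nonempty
    · rw [h0, partitionSum_empty]
    · have h1 := congrFun (h a) S
      have h2 := congrFun (pointedPart_partitionSum a f) S
      rw [pointedPart, if_pos ha] at h1 h2
      rw [h1, h2]
      refine sum_congr rfl fun T hT => ?_
      by_cases haT : a ∈ T
      · rw [ih _ (sdiff_ssubset (mem_powerset.1 hT) ⟨a, haT⟩)]
      · simp [pointedPart, haT]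

theorem partitionSum_add (f g : Finset α → R) :
    partitionSum (f + g) = subsetConv (partitionSum f) (partitionSum g) := by
  refine (eq_partitionSum ?_ fun a => ?_).symm
  · rw [subsetConv_empty, partitionSum_empty, partitionSum_empty, one_mul]
  · rw [pointedPart_subsetConv, pointedPart_partitionSum, pointedPart_partitionSum,
      pointedPart_add, subsetConv_add_left, subsetConv_assoc,
      ← subsetConv_assoc (partitionSum f), subsetConv_comm (partitionSum f) (pointedPart a g),
      subsetConv_assoc]

theorem partitionSum_neg_one_pow_card_mul (f : Finset α → R) (S : Finset α) :
    partitionSum (fun T => (-1) ^ T.card * f T) S = (-1) ^ S.card * partitionSum f S := by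
  simp only [partitionSum, mul_sum, prod_mul_distrib, prod_pow_eq_pow_sum,
    Finpartition.sum_card_parts]

theorem pointedPart_tildeTransform (a : α) (g : Finset α → R) :
    pointedPart a (tildeTransform g) = subsetConv (pointedPart a g) (convInverse g) := by
  funext S
  simp only [pointedPart, subsetConv, tildeTransform, convInverse]
  split_ifs with ha
  · have h := sum_finpartition_of_mem ha fun U A =>
      g U * ((-1 : R) ^ A.card * (Nat.factorial A.card : R) * ∏ V ∈ A, g V)
    simp only [ite_mul, zero_mul]
    simp only [← mul_sum (univ : Finset (Finpartition (_ \ _)))] at h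
    rw [← h]
    refine sum_congr rfl fun P _ => ?_
    rw [card_erase_of_mem (P.part_mem.2 ha), ← mul_prod_erase _ _ (P.part_mem.2 ha)]
    ring
  · refine (sum_eq_zero fun T hT => ?_).symm
    rw [if_neg fun h => ha (mem_powerset.1 hT h), zero_mul]

theorem convInverse_empty (g : Finset α → R) : convInverse g ∅ = 1 := by
  rw [convInverse, sum_finpartition_empty fun A =>
    (-1 : R) ^ A.card * (Nat.factorial A.card : R) * ∏ U ∈ A, g U]
  simp

theorem subsetConv_convInverse {g : Finset α → R} (hg : g ∅ = 1) :
    subsetConv g (convInverse g) = Pi.single ∅ 1 := by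
  funext S
  obtain rfl | hS := S.eq_empty_or_nonempty
  · rw [subsetConv_empty, convInverse_empty, hg, Pi.single_eq_same, one_mul]
  · have h := sum_finpartition_sum_parts S fun U A =>
      -(g U * ((-1 : R) ^ A.card * (Nat.factorial A.card : R) * ∏ V ∈ A, g V))
    have hl (P : Finpartition S) :
        ∑ U ∈ P.parts, -(g U * ((-1 : R) ^ (P.parts.erase U).card *
            (Nat.factorial (P.parts.erase U).card : R) * ∏ V ∈ P.parts.erase U, g V)) =
          (-1 : R) ^ P.parts.card * (Nat.factorial P.parts.card : R) * ∏ U ∈ P.parts, g U := by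
      obtain ⟨k, hk⟩ : ∃ k, P.parts.card = k + 1 :=
        Nat.exists_eq_succ_of_ne_zero (card_pos.2 (P.parts_nonempty hS.ne_empty)).ne'
      have (U) (hU : U ∈ P.parts) : -(g U * ((-1 : R) ^ (P.parts.erase U).card *
            (Nat.factorial (P.parts.erase U).card : R) * ∏ V ∈ P.parts.erase U, g V)) =
          (-1 : R) ^ (k + 1) * (Nat.factorial k : R) * ∏ U ∈ P.parts, g U := by
        rw [card_erase_of_mem hU, hk, ← mul_prod_erase _ _ hU, Nat.add_sub_cancel]
        ring
      rw [sum_congr rfl this, sum_const, hk, Nat.factorial_succ, nsmul_eq_mul]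
      push_cast
      ring
    simp_rw [hl, sum_neg_distrib, ← mul_sum] at h
    change convInverse g S = ∑ U ∈ S.powerset,
      if U.Nonempty then -(g U * convInverse g (S \ U)) else 0 at h
    rw [Pi.single_eq_of_ne hS.ne_empty, subsetConv,
      ← add_sum_erase _ _ (empty_mem_powerset S), hg, one_mul, sdiff_empty, h,
      ← add_sum_erase _ _ (empty_mem_powerset S), if_neg Finset.not_nonempty_empty, zero_add,
      ← sum_add_distrib]
    refine sum_eq_zero fun U hU => ?_
    rw [if_pos (nonempty_iff_ne_empty.2 (ne_of_mem_erase hU)), neg_add_cancel]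

theorem subsetConv_pointedPart_tildeTransform (a : α) {g : Finset α → R} (hg : g ∅ = 1) :
    subsetConv (pointedPart a (tildeTransform g)) g = pointedPart a g := by
  rw [pointedPart_tildeTransform, subsetConv_assoc, subsetConv_comm (convInverse g),
    subsetConv_convInverse hg, subsetConv_single_empty]

theorem partitionSum_tildeTransform {g : Finset α → R} (hg : g ∅ = 1) :
    partitionSum (tildeTransform g) = g :=
  (eq_partitionSum hg fun a => (subsetConv_pointedPart_tildeTransform a hg).symm).symm

theorem partitionSum_congr {f g : Finset α → R} {S : Finset α} (h : ∀ T ⊆ S, f T = g T) :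
    partitionSum f S = partitionSum g S :=
  sum_congr rfl fun P _ => prod_congr rfl fun _ hU => h _ (P.subset hU)

/-- The two-point identity on an arbitrary finset `S` with a distinguished element `a`. -/
theorem partitionSum_two_point {S : Finset α} {a : α} (ha : a ∈ S) {gb gs : Finset α → R}
    (hgb : gb ∅ = 1) (hgs : gs ∅ = 1) :
    partitionSum (fun T => if a ∈ T then tildeTransform gb T
        else tildeTransform gb T + (-1 : R) ^ T.card * tildeTransform gs T) S =
      subsetConv (pointedPart a gb) (fun T => (-1 : R) ^ T.card * gs T) S := by
  set φ : Finset α → R := fun T => if a ∈ T then tildeTransform gb T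
    else tildeTransform gb T + (-1 : R) ^ T.card * tildeTransform gs T with hφ
  have hψ : partitionSum
      (tildeTransform gb + fun T => (-1 : R) ^ T.card * tildeTransform gs T) =
        subsetConv gb (fun T => (-1 : R) ^ T.card * gs T) := by
    rw [partitionSum_add, partitionSum_tildeTransform hgb]
    congr 1
    funext T
    rw [partitionSum_neg_one_pow_card_mul, partitionSum_tildeTransform hgs]
  have h := congrFun (pointedPart_partitionSum a φ) S
  rw [pointedPart, if_pos ha] at h
  rw [h, ← subsetConv_pointedPart_tildeTransform a hgb, subsetConv_assoc, ← hψ]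
  refine sum_congr rfl fun T _ => ?_
  by_cases haT : a ∈ T
  · simp only [pointedPart, if_pos haT]
    congr 1
    · simp [hφ, haT]
    · refine partitionSum_congr fun U hU => ?_
      have haU : a ∉ U := fun h => (mem_sdiff.1 (hU h)).2 haT
      simp [hφ, haU]
  · simp [pointedPart, haT]

end

/-- Let `R` be a commutative ring, `ℓ ≥ 1`, and `g_b`, `g_s` functions on subsets of
`{1,…,ℓ}` with `g_b(∅) = g_s(∅) = 1`.  Then
`∑_Q g̃_b(Q₁) ∏_{S ∈ Q, S ≠ Q₁} (g̃_b(S) + (−1)^{|S|} g̃_s(S))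
  = ∑_{B ⊆ {2,…,ℓ}} (−1)^{|B|} g_b({1,…,ℓ} ∖ B) g_s(B)`,
where `Q` runs over all set partitions of `{1,…,ℓ}` and `Q₁` is the part containing `1`
(here the element `1 ∈ {1,…,ℓ}` is modelled by `⟨0, hℓ⟩ : Fin ℓ`; the factor attached to a
part `S` of `Q` is `g̃_b(S)` when `1 ∈ S` and `g̃_b(S) + (−1)^{|S|} g̃_s(S)` otherwise). -/
theorem tilde_two_point_identity {R : Type*} [CommRing R] (ℓ : ℕ) (hℓ : 0 < ℓ)
    (gb gs : Finset (Fin ℓ) → R) (hgb : gb ∅ = 1) (hgs : gs ∅ = 1) :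
    (∑ Q : Finpartition (Finset.univ : Finset (Fin ℓ)),
        ∏ S ∈ Q.parts,
          (if (⟨0, hℓ⟩ : Fin ℓ) ∈ S then tildeTransform gb S
           else tildeTransform gb S + (-1 : R) ^ S.card * tildeTransform gs S))
      = ∑ B ∈ ((Finset.univ : Finset (Fin ℓ)) \ {(⟨0, hℓ⟩ : Fin ℓ)}).powerset,
          (-1 : R) ^ B.card * gb (Finset.univ \ B) * gs B := by
  refine (partitionSum_two_point (mem_univ _) hgb hgs).trans ?_
  rw [subsetConv_comm, subsetConv]
  symm
  refine sum_subset_zero_on_sdiff (powerset_mono.2 sdiff_subset) (fun B hB => ?_) fun B hB => ?_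
  · have h0 : (⟨0, hℓ⟩ : Fin ℓ) ∈ B := by
      simpa [subset_sdiff] using hB
    simp [pointedPart, h0]
  · have h0 : (⟨0, hℓ⟩ : Fin ℓ) ∉ B := by
      simpa [subset_sdiff] using hB
    simp only [pointedPart, mem_sdiff, mem_univ, h0, not_false_eq_true, and_self, if_true]
    ring
end

section
/- Let ℓ ≥ 0 and m ≥ 0 be integers with ℓ + m ≥ 1, and let μ_1, …, μ_ℓ be integers, each at least 2. Put A = (∑_{k=1}^ℓ μ_k) + 2m − 2 and b = (∑_{k=1}^ℓ μ_k) + ℓ + 2m, and define g : ℚ → ℚ by g(c) = (c+1)^b − 2 c^b + (c−1)^b. Then ∑_{j=0}^{A} ∑_{ε ∈ {−1,1}^ℓ} (−1)^{A−j} · binom(A,j) · (∏_{k=1}^ℓ ε_k) · g( j − A/2 + (1/2) ∑_{k=1}^ℓ ε_k μ_k ) = b! · ∏_{k=1}^ℓ μ_k. -/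
open Finset

/-- The function `g(c) = (c+1)^b − 2 c^b + (c−1)^b` on `ℚ`. -/
def secondDifferencePow (b : ℕ) (c : ℚ) : ℚ :=
  (c + 1) ^ b - 2 * c ^ b + (c - 1) ^ b

/-- `f` is given by a polynomial of degree at most `n` whose coefficient of `x ^ n` is `a / n!`. -/
def IsPolynomialWithTop (n : ℕ) (a : ℚ) (f : ℚ → ℚ) : Prop :=
  ∃ P : Polynomial ℚ, P.natDegree ≤ n ∧ (n.factorial : ℚ) * P.coeff n = a ∧ ∀ x, f x = P.eval x

namespace IsPolynomialWithTop

theorem pow (n : ℕ) : IsPolynomialWithTop n n.factorial (fun x => x ^ n) :=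
  ⟨Polynomial.X ^ n, by simp, by simp, by simp⟩

theorem eq_of_zero {a : ℚ} {f : ℚ → ℚ} (hf : IsPolynomialWithTop 0 a f) (x : ℚ) : f x = a := by
  obtain ⟨P, hP, ha, hfP⟩ := hf
  rw [hfP, Polynomial.eq_C_of_natDegree_le_zero hP, Polynomial.eval_C, ← ha]
  simp

theorem sub_shift {n : ℕ} {a : ℚ} {f : ℚ → ℚ} (hf : IsPolynomialWithTop (n + 1) a f) (u v : ℚ) :
    IsPolynomialWithTop n (a * (u - v)) (fun x => f (x + u) - f (x + v)) := by
  obtain ⟨P, hP, ha, hfP⟩ := hf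
  refine ⟨Polynomial.taylor u P - Polynomial.taylor v P, ?_, ?_, fun x => ?_⟩
  · rw [Polynomial.natDegree_le_iff_coeff_eq_zero]
    intro N hN
    have h : (Polynomial.hasseDeriv N P).natDegree ≤ 0 :=
      (Polynomial.natDegree_hasseDeriv_le P N).trans (by lia)
    rw [Polynomial.coeff_sub, Polynomial.taylor_coeff, Polynomial.taylor_coeff,
      Polynomial.eq_C_of_natDegree_le_zero h, Polynomial.eval_C, Polynomial.eval_C, sub_self]
  · have h : (Polynomial.hasseDeriv n P).natDegree ≤ 1 :=
      (Polynomial.natDegree_hasseDeriv_le P n).trans (by lia)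
    rw [Polynomial.coeff_sub, Polynomial.taylor_coeff, Polynomial.taylor_coeff,
      Polynomial.eq_X_add_C_of_natDegree_le_one h, ← ha, Nat.factorial_succ]
    simp only [Polynomial.hasseDeriv_coeff, Polynomial.eval_add, Polynomial.eval_mul,
      Polynomial.eval_C, Polynomial.eval_X, add_comm 1 n, Nat.choose_succ_self_right]
    push_cast
    ring
  · simp [hfP, Polynomial.taylor_eval]

theorem fwdDiff_iterate {n k : ℕ} {a : ℚ} {f : ℚ → ℚ} (hf : IsPolynomialWithTop (n + k) a f) :
    IsPolynomialWithTop n a ((fwdDiff 1)^[k] f) := by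
  induction k generalizing f with
  | zero => exact hf
  | succ k ih =>
    rw [Function.iterate_succ_apply]
    refine ih ?_
    have h := sub_shift (n := n + k) hf 1 0
    simp only [sub_zero, mul_one, add_zero] at h
    exact h

theorem secondDifferencePow (n : ℕ) :
    IsPolynomialWithTop n (n + 2).factorial (secondDifferencePow (n + 2)) := by
  have h := ((pow (n + 2)).sub_shift (1 / 2) (-1 / 2)).sub_shift (1 / 2) (-1 / 2)
  convert h using 1
  · norm_num
  · funext x
    simp only [_root_.secondDifferencePow]
    ring_nf

theorem sum_signs {n ℓ : ℕ} {a : ℚ} {f : ℚ → ℚ} (hf : IsPolynomialWithTop (n + ℓ) a f)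
    (μ : Fin ℓ → ℚ) :
    IsPolynomialWithTop n (a * ∏ k, μ k) (fun x =>
      ∑ ε : Fin ℓ → ({-1, 1} : Finset ℤ), (∏ k, ((ε k : ℤ) : ℚ)) *
        f (x + (1 / 2) * ∑ k, ((ε k : ℤ) : ℚ) * μ k)) := by
  induction ℓ generalizing a f with
  | zero => simpa using hf
  | succ ℓ ih =>
    have h := ih (sub_shift (n := n + ℓ) hf (μ 0 / 2) (-μ 0 / 2)) (fun k => μ k.succ)
    convert h using 1
    · rw [Fin.prod_univ_succ]
      ring
    · funext x
      rw [← (Fin.consEquiv fun _ : Fin (ℓ + 1) => ({-1, 1} : Finset ℤ)).sum_comp,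
        Fintype.sum_prod_type_right]
      refine Finset.sum_congr rfl fun ε _ => ?_
      simp only [Fin.consEquiv_apply, Fin.prod_univ_succ, Fin.sum_univ_succ, Fin.cons_zero,
        Fin.cons_succ]
      rw [Finset.sum_coe_sort ({-1, 1} : Finset ℤ) (fun s => ((s : ℚ) * ∏ k, ((ε k : ℤ) : ℚ)) *
        f (x + (1 / 2) * ((s : ℚ) * μ 0 + ∑ k, ((ε k : ℤ) : ℚ) * μ k.succ))),
        Finset.sum_pair (by decide)]
      push_cast
      ring_nf

end IsPolynomialWithTop

/-- Let `ℓ, m ≥ 0` with `ℓ + m ≥ 1`, and let `μ_1, …, μ_ℓ` be integers, each at least `2`.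
Put `A = (∑ μ_k) + 2m − 2` and `b = (∑ μ_k) + ℓ + 2m`, and `g(c) = (c+1)^b − 2c^b + (c−1)^b`.
Then `∑_{j=0}^{A} ∑_{ε ∈ {−1,1}^ℓ} (−1)^{A−j} binom(A,j) (∏_k ε_k)
  g(j − A/2 + (1/2) ∑_k ε_k μ_k) = b! ∏_k μ_k`. -/
theorem character_sum_replacement_identity (ℓ m A b : ℕ) (hlm : 1 ≤ ℓ + m)
    (μ : Fin ℓ → ℕ) (hμ : ∀ k, 2 ≤ μ k)
    (hA : A + 2 = (∑ k, μ k) + 2 * m) (hb : b = (∑ k, μ k) + ℓ + 2 * m) :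
    (∑ j ∈ Finset.range (A + 1),
        ∑ ε : Fin ℓ → ({-1, 1} : Finset ℤ),
          (-1 : ℚ) ^ (A - j) * (A.choose j : ℚ) * (∏ k, ((ε k : ℤ) : ℚ)) *
            secondDifferencePow b
              ((j : ℚ) - (A : ℚ) / 2 + (1 / 2) * ∑ k, ((ε k : ℤ) : ℚ) * (μ k : ℚ)))
      = (Nat.factorial b : ℚ) * ∏ k, (μ k : ℚ) := by
  obtain rfl : b = A + ℓ + 2 := by lia
  have h := (IsPolynomialWithTop.secondDifferencePow (A + ℓ)).sum_signs fun k => (μ k : ℚ)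
  have hΔ := IsPolynomialWithTop.fwdDiff_iterate (n := 0) (k := A) (by rwa [zero_add])
  rw [← hΔ.eq_of_zero (-A / 2), fwdDiff_iter_eq_sum_shift]
  refine Finset.sum_congr (by simp) fun j _ => ?_
  simp only [zsmul_eq_mul, Finset.mul_sum]
  refine Finset.sum_congr rfl fun ε _ => ?_
  push_cast
  ring_nf
end
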